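/- arXiv:1711.08661 — 5 statements merged into one kernel-verified Lean document; each statement's English description precedes it below -/
import Mathlib

section
/- Let N, l ≥ 1 be integers and let γ₁,…,γ_s be pairwise distinct elements of {1,…,Nl}. Set b = ∑_{j=1}^{s−1} |n(γ_{j+1}) − n(γ_j)|. Then s ≤ (b+1)·l. -/
noncomputable section

/-- The block index `n(γ)` of a scalar index `γ ∈ {1,…,Nl}`: the unique `n` with
`γ = l(n−1) + r`, `1 ≤ r ≤ l`; explicitly `n(γ) = (γ−1)/l + 1`. -/
def blockIdx (l γ : ℕ) : ℕ := (γ - 1) / l + 1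

/-- The number of values of a sequence of natural numbers is at most one more than its total variation. -/
theorem card_image_range_le_variation (f : ℕ → ℕ) (k : ℕ) :
    ((Finset.range (k + 1)).image f).card ≤
      (∑ i ∈ Finset.range k, ((f (i + 1) : ℤ) - (f i : ℤ)).natAbs) + 1 := by
  induction k with
  | zero => simp
  | succ k ih =>
    rw [Finset.sum_range_succ, Finset.range_add_one, Finset.image_insert]
    by_cases h : f (k + 1) = f k
    · rw [Finset.insert_eq_of_mem
        (Finset.mem_image.mpr ⟨k, Finset.self_mem_range_succ k, h.symm⟩)]
      omega
    · have := Finset.card_insert_le (f (k + 1)) ((Finset.range (k + 1)).image f)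
      omega

/-- The positive integers with a given block index lie in an interval of length `l`. -/
theorem mem_Icc_of_blockIdx_eq {l γ n : ℕ} (hl : 1 ≤ l) (hγ : 1 ≤ γ)
    (h : blockIdx l γ = n) : γ ∈ Finset.Icc (l * (n - 1) + 1) (l * (n - 1) + l) := by
  subst h
  have hdiv := Nat.div_add_mod (γ - 1) l
  have hmod := Nat.mod_lt (γ - 1) hl
  simp only [blockIdx, Nat.add_sub_cancel, Finset.mem_Icc]
  omega

/-- **Lemma.** If `γ₁,…,γ_s` are pairwise distinct elements of `{1,…,Nl}` and
`b = ∑_{j=1}^{s−1} |n(γ_{j+1}) − n(γ_j)|`, then `s ≤ (b+1)·l`. -/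
theorem path_length_bound (N l : ℕ) (hN : 1 ≤ N) (hl : 1 ≤ l) (s : ℕ) (γ : ℕ → ℕ)
    (hinj : ∀ i < s, ∀ j < s, γ i = γ j → i = j)
    (hrange : ∀ i < s, 1 ≤ γ i ∧ γ i ≤ N * l)
    (b : ℕ)
    (hb : b = ∑ i ∈ Finset.range (s - 1),
        ((blockIdx l (γ (i + 1)) : ℤ) - (blockIdx l (γ i) : ℤ)).natAbs) :
    s ≤ (b + 1) * l := by
  rcases Nat.eq_zero_or_pos s with rfl | hs
  · exact Nat.zero_le _
  have hvalues := card_image_range_le_variation (fun i => blockIdx l (γ i)) (s - 1)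
  rw [Nat.sub_add_cancel hs, ← hb] at hvalues
  have hfiber : ∀ n ∈ (Finset.range s).image (fun i => blockIdx l (γ i)),
      ((Finset.range s).filter (fun i => blockIdx l (γ i) = n)).card ≤ l := by
    intro n _
    calc ((Finset.range s).filter (fun i => blockIdx l (γ i) = n)).card
        ≤ (Finset.Icc (l * (n - 1) + 1) (l * (n - 1) + l)).card := by
          refine Finset.card_le_card_of_injOn γ (fun i hi => ?_) (fun i hi j hj hij => ?_)
          · simp only [Finset.coe_filter, Finset.mem_range, Set.mem_ofPred_eq] at hi
            exact mem_Icc_of_blockIdx_eq hl (hrange i hi.1).1 hi.2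
          · simp only [Finset.coe_filter, Finset.mem_range, Set.mem_ofPred_eq] at hi hj
            exact hinj i hi.1 j hj.1 hij
      _ = l := by rw [Nat.card_Icc]; omega
  have hcard := Finset.card_le_mul_card_image (Finset.range s) l hfiber
  rw [Finset.card_range] at hcard
  calc s ≤ l * ((Finset.range s).image (fun i => blockIdx l (γ i))).card := hcard
    _ ≤ l * (b + 1) := Nat.mul_le_mul_left l hvalues
    _ = (b + 1) * l := Nat.mul_comm _ _

end
end

section
/- Let v be a nonconstant real analytic function on 𝕋. Then there exists δ = δ(v) > 0 such that for every t > 0, every ω ∈ DC_t and every integer l ≥ 1 there is ε₀ > 0 with the following property: for every 0 < ε ≤ ε₀ there is N₀ such that for all N ≥ N₀, all E ∈ ℝ, and every subset Γ ⊂ {1,…,Nl} of cardinality s with s > ε^δ·Nl, one has inf_{x∈𝕋} ∑_{k∈Γ} log(|v(x+kω)−E| + ε) ≥ (3/4)·s·log ε. -/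
noncomputable section

/-- `ω` satisfies the Diophantine condition `DC_t`. -/
def IsDioph (t ω : ℝ) : Prop :=
  ∀ k : ℤ, k ≠ 0 → ∀ m : ℤ, t / (k : ℝ) ^ 2 ≤ |(k : ℝ) * ω - (m : ℝ)|

open Polynomial in
lemma iteratedDeriv_polynomial_eval (P : ℝ[X]) (k : ℕ) :
    iteratedDeriv k (fun x => P.eval x) = fun x => (derivative^[k] P).eval x := by
  induction k generalizing P with
  | zero => simp
  | succ k ih =>
    rw [iteratedDeriv_succ', Function.iterate_succ_apply, ← ih]
    congr 1
    funext x
    exact P.deriv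

/-- Iterated Rolle theorem: a function with `n + 1` zeros in an interval has a zero of its
`n`-th derivative in that interval. -/
lemma exists_iteratedDeriv_eq_zero_of_card_zeros {I : Set ℝ} (hI : I.OrdConnected) {n : ℕ}
    {g : ℝ → ℝ} (hg : ContDiff ℝ n g) {Z : Finset ℝ} (hcard : Z.card = n + 1)
    (hZI : ∀ z ∈ Z, z ∈ I) (hz : ∀ z ∈ Z, g z = 0) :
    ∃ ξ ∈ I, iteratedDeriv n g ξ = 0 := by
  induction n generalizing g Z with
  | zero =>
    obtain ⟨z, hzZ⟩ : Z.Nonempty := Finset.card_pos.mp (by omega)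
    exact ⟨z, hZI z hzZ, by simpa using hz z hzZ⟩
  | succ n ih =>
    let e := Z.orderEmbOfFin hcard
    have he (i) : e i ∈ Z := Z.orderEmbOfFin_mem hcard i
    have hrolle (i : Fin (n + 1)) : ∃ c ∈ Set.Ioo (e i.castSucc) (e i.succ), deriv g c = 0 :=
      exists_deriv_eq_zero (e.strictMono i.castSucc_lt_succ) hg.continuous.continuousOn
        ((hz _ (he _)).trans (hz _ (he _)).symm)
    choose c hc hc0 using hrolle
    have hmono : StrictMono c := by
      rw [Fin.strictMono_iff_lt_succ]
      intro i
      have h1 := (hc i.castSucc).2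
      have h2 := (hc i.succ).1
      rw [Fin.succ_castSucc] at h1
      exact h1.trans h2
    rw [iteratedDeriv_succ']
    refine ih (Z := Finset.univ.map ⟨c, hmono.injective⟩) ?_ (by simp) ?_ ?_
    · have := hg
      rw [Nat.cast_add, Nat.cast_one, contDiff_succ_iff_deriv] at this
      exact this.2.2
    · simp only [Finset.mem_map, Finset.mem_univ, true_and, Function.Embedding.coeFn_mk,
        forall_exists_index, forall_apply_eq_imp_iff]
      exact fun i => hI.out (hZI _ (he _)) (hZI _ (he _)) (Set.Ioo_subset_Icc_self (hc i))
    · simpa using hc0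

/-- A function that is small at `m + 1` separated points has a point with small `m`-th
derivative. -/
lemma exists_abs_iteratedDeriv_le {I : Set ℝ} (hI : I.OrdConnected) {m : ℕ} {f : ℝ → ℝ}
    (hf : ContDiff ℝ m f) {Z : Finset ℝ} (hcard : Z.card = m + 1) (hZI : ∀ z ∈ Z, z ∈ I)
    {η d : ℝ} (hη : ∀ z ∈ Z, |f z| ≤ η) (hd : 0 < d)
    (hsep : ∀ z ∈ Z, ∀ w ∈ Z, z ≠ w → d ≤ |z - w|) :
    ∃ ξ ∈ I, |iteratedDeriv m f ξ| ≤ m.factorial * ((m + 1) * (η / d ^ m)) := by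
  set P := Lagrange.interpolate Z id f with hP
  have hinj : Set.InjOn (id : ℝ → ℝ) Z := Function.injective_id.injOn
  have hPdiff : ContDiff ℝ m (fun x => P.eval x) := by
    simpa using P.contDiff_aeval (𝕜 := ℝ) m
  obtain ⟨ξ, hξ, h0⟩ := exists_iteratedDeriv_eq_zero_of_card_zeros hI (hf.sub hPdiff) hcard hZI
    (fun z hz => by
      have := Lagrange.eval_interpolate_at_node f hinj hz
      simp only [id] at this
      rw [hP, this, sub_self])
  refine ⟨ξ, hξ, ?_⟩
  rw [iteratedDeriv_fun_sub hf.contDiffAt hPdiff.contDiffAt, iteratedDeriv_polynomial_eval,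
    sub_eq_zero] at h0
  rw [h0, hP, Lagrange.iterate_derivative_interpolate f hinj (by omega)]
  simp only [hcard, Nat.sub_self, Finset.powersetCard_zero, Finset.sum_singleton,
    Finset.prod_empty, mul_one, id]
  rw [Polynomial.eval_mul, Polynomial.eval_natCast, Polynomial.eval_finsetSum, abs_mul,
    Nat.abs_cast]
  gcongr
  refine (Finset.abs_sum_le_sum_abs _ _).trans ((Finset.sum_le_card_nsmul Z _ (η / d ^ m) ?_).trans
    (by simp [hcard]))
  intro z hz
  have hprod : d ^ m ≤ ∏ j ∈ Z.erase z, |z - j| := by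
    have : m = (Z.erase z).card := by rw [Finset.card_erase_of_mem hz]; omega
    rw [this]
    rw [← Finset.prod_const]
    refine Finset.prod_le_prod (fun _ _ => hd.le) fun j hj => ?_
    exact hsep z hz j (Finset.mem_of_mem_erase hj) (Finset.ne_of_mem_erase hj).symm
  rw [Polynomial.eval_C, abs_div, Finset.abs_prod]
  exact div_le_div₀ ((abs_nonneg _).trans (hη z hz)) (hη z hz) (by positivity) hprod

/-- Any set without `m + 1` pairwise `d`-separated points is covered by `m` closed balls of
radius `d`. -/
lemma exists_finset_cover_of_card_separated_le {S : Set ℝ} {m : ℕ} {d : ℝ} (hd : 0 ≤ d)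
    (h : ∀ Z : Finset ℝ, (∀ z ∈ Z, z ∈ S) → (∀ z ∈ Z, ∀ w ∈ Z, z ≠ w → d ≤ |z - w|) →
      Z.card ≠ m + 1) :
    ∃ A : Finset ℝ, A.card ≤ m ∧ ∀ y ∈ S, ∃ c ∈ A, |y - c| ≤ d := by
  induction m with
  | zero =>
    refine ⟨∅, le_rfl, fun y hy => ?_⟩
    exact absurd (Finset.card_singleton y) (h {y} (by simpa using hy) (by simp))
  | succ m ih =>
    by_cases h' : ∃ Z : Finset ℝ, (∀ z ∈ Z, z ∈ S) ∧
        (∀ z ∈ Z, ∀ w ∈ Z, z ≠ w → d ≤ |z - w|) ∧ Z.card = m + 1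
    · obtain ⟨Z, hZS, hsep, hcard⟩ := h'
      refine ⟨Z, hcard.le, fun y hy => ?_⟩
      by_contra! hfar
      have hyZ : y ∉ Z := fun hyZ => absurd (hfar y hyZ) (by simpa using hd)
      refine h (insert y Z) ?_ ?_ (by rw [Finset.card_insert_of_notMem hyZ, hcard])
      · simpa using ⟨hy, hZS⟩
      · intro z hz w hw hzw
        rcases Finset.mem_insert.mp hz with rfl | hzZ <;>
          rcases Finset.mem_insert.mp hw with rfl | hwZ
        · exact absurd rfl hzw
        · exact (hfar w hwZ).le
        · rw [abs_sub_comm]; exact (hfar z hzZ).le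
        · exact hsep z hzZ w hwZ hzw
    · push Not at h'
      obtain ⟨A, hA, hcov⟩ := ih h'
      exact ⟨A, hA.trans m.le_succ, hcov⟩

/-- A set of integers in `{1, …, n}` with gaps at least `D` has at most `n / D + 1` elements. -/
lemma card_sub_one_mul_le_of_gaps {D : ℝ} (B : Finset ℕ) :
    ∀ n : ℕ, B ⊆ Finset.Icc 1 n → (∀ i ∈ B, ∀ j ∈ B, i < j → D ≤ (j : ℝ) - i) →
      ((B.card : ℝ) - 1) * D ≤ n ∨ B = ∅ := by
  induction B using Finset.induction_on_max with
  | empty => simp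
  | insert a B hlt ih =>
    intro n hB hgap
    left
    have haB : a ∉ B := fun h => (hlt a h).false
    have han : a ≤ n := (Finset.mem_Icc.mp (hB (Finset.mem_insert_self a B))).2
    have han' : (a : ℝ) ≤ n := by exact_mod_cast han
    rw [Finset.card_insert_of_notMem haB]
    rcases B.eq_empty_or_nonempty with rfl | hne
    · simp
    have hb := B.max'_mem hne
    have hgap' := hgap _ (Finset.mem_insert_of_mem hb) a (Finset.mem_insert_self a B) (hlt _ hb)
    rcases ih (B.max' hne)
      (fun k hk => Finset.mem_Icc.mpr
        ⟨(Finset.mem_Icc.mp (hB (Finset.mem_insert_of_mem hk))).1, B.le_max' k hk⟩)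
      (fun i hi j hj => hgap i (Finset.mem_insert_of_mem hi) j (Finset.mem_insert_of_mem hj))
      with h | h
    · push_cast
      linarith
    · exact absurd h hne.ne_empty

/-- The orbit of a Diophantine rotation visits an interval of length `L` at most
`n √(L / t) + 1` times up to time `n`. -/
lemma card_visits_le {t ω L : ℝ} (ht : 0 < t) (hω : IsDioph t ω) (hL : 0 < L) {n : ℕ}
    {B : Finset ℕ} (hB : B ⊆ Finset.Icc 1 n)
    (hclose : ∀ i ∈ B, ∀ j ∈ B, ∃ m : ℤ, |((j : ℝ) - i) * ω - m| ≤ L) :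
    (B.card : ℝ) ≤ n * √(L / t) + 1 := by
  rcases B.eq_empty_or_nonempty with rfl | hne
  · simp; positivity
  have hgap : ∀ i ∈ B, ∀ j ∈ B, i < j → √(t / L) ≤ (j : ℝ) - i := by
    intro i hi j hj hij
    obtain ⟨m, hm⟩ := hclose i hi j hj
    have hpos : (0 : ℝ) < (j : ℝ) - i := sub_pos.mpr (by exact_mod_cast hij)
    have h := (hω ((j : ℤ) - i) (by omega) m)
    push_cast at h
    have h' := h.trans hm
    rw [div_le_iff₀ (by positivity)] at h'
    rw [Real.sqrt_le_left hpos.le, div_le_iff₀ hL]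
    linarith
  rcases card_sub_one_mul_le_of_gaps B n hB hgap with h | h
  · have hs : √(t / L) * √(L / t) = 1 := by
      rw [← Real.sqrt_mul (by positivity), div_mul_div_cancel₀ hL.ne', div_self ht.ne',
        Real.sqrt_one]
    have := mul_le_mul_of_nonneg_right h (Real.sqrt_nonneg (L / t))
    rw [mul_assoc, hs] at this
    linarith
  · exact absurd h hne.ne_empty

/-- The sublevel sets `{y ∈ S : |v y - E| < η}` are covered, uniformly in `E`, by a bounded number
of intervals whose length is a power of `η`. -/
def HasSublevelCover (v : ℝ → ℝ) (S : Set ℝ) : Prop :=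
  ∃ M : ℕ, ∃ a > (0 : ℝ), ∃ C > (0 : ℝ), ∀ η : ℝ, 0 < η → η ≤ 1 → ∀ E : ℝ,
    ∃ A : Finset ℝ, A.card ≤ M ∧ ∀ y ∈ S, |v y - E| < η → ∃ c ∈ A, |y - c| ≤ C * η ^ a

lemma HasSublevelCover.mono {v : ℝ → ℝ} {S T : Set ℝ} (hST : S ⊆ T) (hT : HasSublevelCover v T) :
    HasSublevelCover v S := by
  obtain ⟨M, a, ha, C, hC, h⟩ := hT
  refine ⟨M, a, ha, C, hC, fun η h0 h1 E => ?_⟩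
  obtain ⟨A, hA, hcov⟩ := h η h0 h1 E
  exact ⟨A, hA, fun y hy => hcov y (hST hy)⟩

lemma HasSublevelCover.union {v : ℝ → ℝ} {S T : Set ℝ} (hS : HasSublevelCover v S)
    (hT : HasSublevelCover v T) : HasSublevelCover v (S ∪ T) := by
  classical
  obtain ⟨M, a, ha, C, hC, h⟩ := hS
  obtain ⟨M', a', ha', C', hC', h'⟩ := hT
  refine ⟨M + M', min a a', lt_min ha ha', max C C', lt_max_of_lt_left hC, fun η h0 h1 E => ?_⟩
  obtain ⟨A, hA, hcov⟩ := h η h0 h1 E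
  obtain ⟨A', hA', hcov'⟩ := h' η h0 h1 E
  refine ⟨A ∪ A', (Finset.card_union_le A A').trans (add_le_add hA hA'), ?_⟩
  rintro y (hy | hy) hyE
  · obtain ⟨c, hc, hyc⟩ := hcov y hy hyE
    refine ⟨c, Finset.mem_union_left _ hc, hyc.trans ?_⟩
    exact mul_le_mul (le_max_left _ _)
      (Real.rpow_le_rpow_of_exponent_ge h0 h1 (min_le_left _ _)) (by positivity) (by positivity)
  · obtain ⟨c, hc, hyc⟩ := hcov' y hy hyE
    refine ⟨c, Finset.mem_union_right _ hc, hyc.trans ?_⟩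
    exact mul_le_mul (le_max_right _ _)
      (Real.rpow_le_rpow_of_exponent_ge h0 h1 (min_le_right _ _)) (by positivity) (by positivity)

/-- On an interval where some derivative of positive order is bounded away from zero, the sublevel
sets are covered by few short intervals. -/
lemma hasSublevelCover_of_le_abs_iteratedDeriv {v : ℝ → ℝ} {I : Set ℝ} (hI : I.OrdConnected)
    {m : ℕ} (hm : m ≠ 0) (hv : ContDiff ℝ m v) {b : ℝ} (hb : 0 < b)
    (hder : ∀ y ∈ I, b ≤ |iteratedDeriv m v y|) : HasSublevelCover v I := by
  have hm0 : (0 : ℝ) < m := by exact_mod_cast Nat.pos_of_ne_zero hm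
  set K : ℝ := m.factorial * (m + 1) / b + 1 with hK
  have hfac : (0 : ℝ) < m.factorial := by exact_mod_cast m.factorial_pos
  have hK0 : 0 < K := by positivity
  refine ⟨m, 1 / m, by positivity, K ^ (1 / m : ℝ), by positivity, fun η h0 h1 E => ?_⟩
  rw [← Real.mul_rpow hK0.le h0.le]
  set d : ℝ := (K * η) ^ (1 / m : ℝ) with hd
  have hd0 : 0 < d := by positivity
  have hdm : d ^ m = K * η := by
    rw [hd, one_div, Real.rpow_inv_natCast_pow (by positivity) hm]
  obtain ⟨A, hA, hcov⟩ := exists_finset_cover_of_card_separated_le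
    (S := {y | y ∈ I ∧ |v y - E| < η}) (m := m) hd0.le (by
      intro Z hZ hsep hcard
      obtain ⟨ξ, hξ, hle⟩ := exists_abs_iteratedDeriv_le hI (f := fun y => v y - E)
        (hv.sub contDiff_const) hcard (fun z hz => (hZ z hz).1) (fun z hz => (hZ z hz).2.le)
        hd0 hsep
      rw [iteratedDeriv_fun_sub hv.contDiffAt contDiffAt_const, iteratedDeriv_const, if_neg hm,
        sub_zero, hdm] at hle
      have hbK : b * K = m.factorial * (m + 1) + b := by
        rw [hK]; field_simp
      have h2 := (hder ξ hξ).trans hle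
      have h3 : (m.factorial : ℝ) * ((m + 1) * (η / (K * η))) = m.factorial * (m + 1) / K := by
        field_simp
      rw [h3, le_div_iff₀ hK0, hbK] at h2
      linarith)
  exact ⟨A, hA, fun y hy hyE => hcov y ⟨hy, hyE⟩⟩

/-- A nonconstant analytic function has a nonvanishing derivative of positive order at each
point. -/
lemma exists_iteratedDeriv_ne_zero {v : ℝ → ℝ} (hva : ∀ x : ℝ, AnalyticAt ℝ v x)
    (hvnc : ∃ a b : ℝ, v a ≠ v b) (y : ℝ) : ∃ m : ℕ, m ≠ 0 ∧ iteratedDeriv m v y ≠ 0 := by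
  have hw : AnalyticAt ℝ (fun x => v x - v y) y := (hva y).sub analyticAt_const
  have htop : analyticOrderAt (fun x => v x - v y) y ≠ ⊤ := by
    rw [Ne, analyticOrderAt_eq_top]
    intro hev
    have heq : v = fun _ => v y := AnalyticOnNhd.eq_of_eventuallyEq (𝕜 := ℝ)
      (fun x _ => hva x) (fun x _ => analyticAt_const)
      (hev.mono fun x hx => sub_eq_zero.mp hx)
    obtain ⟨a, b, hab⟩ := hvnc
    exact hab ((congrFun heq a).trans (congrFun heq b).symm)
  obtain ⟨m, hm⟩ := ENat.ne_top_iff_exists.mp htop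
  have hne := ((analyticOrderAt_eq_nat_iff_iteratedDeriv_eq_zero hw).mp hm.symm).2
  have hm0 : m ≠ 0 := by
    rintro rfl
    simp at hne
  refine ⟨m, hm0, ?_⟩
  rwa [iteratedDeriv_fun_sub (hva y).contDiffAt contDiffAt_const, iteratedDeriv_const, if_neg hm0,
    sub_zero] at hne

lemma hasSublevelCover_Icc {v : ℝ → ℝ} (hva : ∀ x : ℝ, AnalyticAt ℝ v x)
    (hvnc : ∃ a b : ℝ, v a ≠ v b) (p q : ℝ) : HasSublevelCover v (Set.Icc p q) := by
  refine isCompact_Icc.induction_on (p := HasSublevelCover v) ?_ (fun _ _ h => .mono h)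
    (fun _ _ => .union) ?_
  · exact ⟨0, 1, one_pos, 1, one_pos, fun _ _ _ _ => ⟨∅, by simp⟩⟩
  · intro y _
    obtain ⟨m, hm, hne⟩ := exists_iteratedDeriv_ne_zero hva hvnc y
    have hv : ContDiff ℝ ⊤ v := contDiff_iff_contDiffAt.mpr fun x => (hva x).contDiffAt
    have hcont : Continuous fun z => |iteratedDeriv m v z| :=
      (hv.continuous_iteratedDeriv m le_top).abs
    have hpos : 0 < |iteratedDeriv m v y| := abs_pos.mpr hne
    obtain ⟨r, hr, hball⟩ := Metric.eventually_nhds_iff_ball.mp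
      (hcont.continuousAt.eventually (lt_mem_nhds (half_lt_self hpos)))
    refine ⟨Metric.ball y r, mem_nhdsWithin_of_mem_nhds (Metric.ball_mem_nhds y hr), ?_⟩
    refine hasSublevelCover_of_le_abs_iteratedDeriv ?_ hm (hv.of_le le_top) (half_pos hpos)
      (fun z hz => (hball z hz).le)
    rw [Real.ball_eq_Ioo]
    exact Set.ordConnected_Ioo

/-- If at most half of the indices give a value below `√ε`, the sum of logarithms is at least
`3/4` of the trivial lower bound. -/
lemma sum_log_add_ge {ι : Type*} (Γ : Finset ι) (u : ι → ℝ) (hu : ∀ k ∈ Γ, 0 ≤ u k) {ε : ℝ}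
    (h0 : 0 < ε) (h1 : ε ≤ 1) (hbad : ((Γ.filter (u · < √ε)).card : ℝ) ≤ Γ.card / 2) :
    (3 / 4 : ℝ) * Γ.card * Real.log ε ≤ ∑ k ∈ Γ, Real.log (u k + ε) := by
  have hlog : Real.log ε ≤ 0 := Real.log_nonpos h0.le h1
  rw [← Finset.sum_filter_add_sum_filter_not Γ (u · < √ε)]
  have hsum1 := Finset.card_nsmul_le_sum (Γ.filter (u · < √ε)) (fun k => Real.log (u k + ε))
    (Real.log ε) (fun k hk => Real.log_le_log h0 (by
      linarith [hu k (Finset.mem_of_mem_filter k hk)]))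
  have hsum2 := Finset.card_nsmul_le_sum (Γ.filter (¬ u · < √ε)) (fun k => Real.log (u k + ε))
    (Real.log ε / 2) (fun k hk => by
      rw [← Real.log_sqrt h0.le]
      exact Real.log_le_log (Real.sqrt_pos.mpr h0) (by
        linarith [not_lt.mp (Finset.mem_filter.mp hk).2]))
  have hcard : ((Γ.filter (u · < √ε)).card : ℝ) + (Γ.filter (¬ u · < √ε)).card = Γ.card := by
    exact_mod_cast Finset.card_filter_add_card_filter_not (u · < √ε)
  rw [nsmul_eq_mul] at hsum1 hsum2
  nlinarith

/-- The number of visits of an orbit to a union of `A.card` intervals of radius `r`. -/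
lemma card_le_of_fract_near {t ω r : ℝ} (ht : 0 < t) (hω : IsDioph t ω) (hr : 0 < r) {n : ℕ}
    {B : Finset ℕ} (hB : B ⊆ Finset.Icc 1 n) (A : Finset ℝ) (x : ℝ)
    (hnear : ∀ k ∈ B, ∃ c ∈ A, |Int.fract (x + k * ω) - c| ≤ r) :
    (B.card : ℝ) ≤ A.card * (n * √(2 * r / t) + 1) := by
  classical
  have hsub : B ⊆ A.biUnion fun c => B.filter fun k : ℕ => |Int.fract (x + k * ω) - c| ≤ r := by
    intro k hk
    obtain ⟨c, hc, hkc⟩ := hnear k hk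
    exact Finset.mem_biUnion.mpr ⟨c, hc, Finset.mem_filter.mpr ⟨hk, hkc⟩⟩
  have hcard : (B.card : ℝ) ≤
      ∑ c ∈ A, ((B.filter fun k : ℕ => |Int.fract (x + k * ω) - c| ≤ r).card : ℝ) := by
    exact_mod_cast (Finset.card_le_card hsub).trans Finset.card_biUnion_le
  refine hcard.trans ((Finset.sum_le_card_nsmul A _ _ fun c _ => ?_).trans (nsmul_eq_mul _ _).le)
  refine card_visits_le ht hω (by positivity) ((Finset.filter_subset _ _).trans hB) ?_
  intro i hi j hj
  refine ⟨⌊x + j * ω⌋ - ⌊x + i * ω⌋, ?_⟩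
  have hi' := abs_le.mp (Finset.mem_filter.mp hi).2
  have hj' := abs_le.mp (Finset.mem_filter.mp hj).2
  rw [← Int.self_sub_floor] at hi' hj'
  push_cast
  rw [abs_le]
  constructor <;> linarith [hi'.1, hi'.2, hj'.1, hj'.2]

/-- **Lemma.** For a nonconstant real analytic `v` on `𝕋` there is `δ = δ(v) > 0` such that
for every `t > 0`, `ω ∈ DC_t`, `l ≥ 1`, there is `ε₀ > 0` so that for `0 < ε ≤ ε₀`, for all
large `N`, all `E ∈ ℝ` and all `Γ ⊂ {1,…,Nl}` with `#Γ = s > ε^δ Nl`: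
`inf_x ∑_{k∈Γ} log(|v(x+kω)−E|+ε) ≥ (3/4) s log ε`. -/
theorem sum_log_lower_bound (v : ℝ → ℝ)
    (hva : ∀ x : ℝ, AnalyticAt ℝ v x)
    (hvper : ∀ x : ℝ, v (x + 1) = v x)
    (hvnc : ∃ a b : ℝ, v a ≠ v b) :
    ∃ δ > (0 : ℝ), ∀ t > (0 : ℝ), ∀ ω : ℝ, IsDioph t ω → ∀ l : ℕ, 1 ≤ l →
      ∃ ε₀ > (0 : ℝ), ∀ ε : ℝ, 0 < ε → ε ≤ ε₀ →
        ∃ N₀ : ℕ, ∀ N : ℕ, N₀ ≤ N → ∀ E : ℝ,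
          ∀ Γ : Finset ℕ, Γ ⊆ Finset.Icc 1 (N * l) →
            ε ^ δ * ((N : ℝ) * l) < (Γ.card : ℝ) →
            ∀ x : ℝ,
              (3 / 4 : ℝ) * (Γ.card : ℝ) * Real.log ε ≤
                ∑ k ∈ Γ, Real.log (|v (x + (k : ℝ) * ω) - E| + ε) := by
  obtain ⟨M, a, ha, C, hC, hcover⟩ := hasSublevelCover_Icc hva hvnc 0 1
  refine ⟨a / 8, by positivity, fun t ht ω hω l hl => ?_⟩
  set K : ℝ := M * √(2 * C / t) with hK
  have hK0 : 0 ≤ K := by positivity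
  refine ⟨min 1 ((1 / (4 * (K + 1))) ^ (8 / a)), by positivity, fun ε h0 hε => ?_⟩
  have h1 : ε ≤ 1 := hε.trans (min_le_left _ _)
  set τ : ℝ := ε ^ (a / 8) with hτ
  have hτ0 : 0 < τ := by positivity
  have hτK : K * τ ≤ 1 / 4 := by
    have h : τ ≤ 1 / (4 * (K + 1)) := by
      calc τ ≤ ((1 / (4 * (K + 1))) ^ (8 / a)) ^ (a / 8) :=
            Real.rpow_le_rpow h0.le (hε.trans (min_le_right _ _)) (by positivity)
        _ = 1 / (4 * (K + 1)) := by
            rw [← Real.rpow_mul (by positivity), div_mul_div_cancel₀ ha.ne', div_self (by norm_num),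
              Real.rpow_one]
    rw [le_div_iff₀ (by positivity)] at h
    linarith
  have hroot : √(2 * (C * √ε ^ a) / t) = √(2 * C / t) * τ ^ 2 := by
    have : √ε ^ a = (τ ^ 2) ^ 2 := by
      rw [Real.sqrt_eq_rpow, ← Real.rpow_mul h0.le, hτ, ← Real.rpow_natCast, ← Real.rpow_natCast,
        ← Real.rpow_mul h0.le, ← Real.rpow_mul h0.le]
      congr 1
      push_cast
      ring
    rw [this, show 2 * (C * (τ ^ 2) ^ 2) / t = 2 * C / t * (τ ^ 2) ^ 2 by ring,
      Real.sqrt_mul (by positivity), Real.sqrt_sq (by positivity)]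
  obtain ⟨N₀, hN₀⟩ := exists_nat_ge (4 * M / τ)
  refine ⟨N₀, fun N hN E Γ hΓ hcard x => ?_⟩
  refine sum_log_add_ge Γ (fun k => |v (x + k * ω) - E|) (fun _ _ => abs_nonneg _) h0 h1 ?_
  obtain ⟨A, hA, hcov⟩ := hcover (√ε) (Real.sqrt_pos.mpr h0) (Real.sqrt_le_one.mpr h1) E
  have hvfract (z : ℝ) : v (Int.fract z) = v z := by
    have hper : Function.Periodic v 1 := hvper
    rw [Int.fract, ← zsmul_one (⌊z⌋ : ℤ)]
    exact hper.sub_zsmul_eq ⌊z⌋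
  have hbad := card_le_of_fract_near ht hω (r := C * √ε ^ a) (by positivity)
    ((Finset.filter_subset (fun k : ℕ => |v (x + k * ω) - E| < √ε) Γ).trans hΓ) A x
    (fun k hk => hcov _ ⟨Int.fract_nonneg _, (Int.fract_lt_one _).le⟩
      (by rw [hvfract]; exact (Finset.mem_filter.mp hk).2))
  refine hbad.trans ?_
  rw [hroot]
  push_cast
  set n : ℝ := (N : ℝ) * l with hn
  have hNn : (N : ℝ) ≤ n := le_mul_of_one_le_right (by positivity) (by exact_mod_cast hl)
  have hMn : 4 * (M : ℝ) ≤ τ * n := by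
    have h := hN₀.trans ((Nat.cast_le.mpr hN).trans hNn)
    rw [div_le_iff₀ hτ0] at h
    linarith
  have hn0 : 0 ≤ n := by positivity
  calc (A.card : ℝ) * (n * (√(2 * C / t) * τ ^ 2) + 1)
      ≤ M * (n * (√(2 * C / t) * τ ^ 2) + 1) := by gcongr
    _ = (K * τ) * (τ * n) + M := by rw [hK]; ring
    _ ≤ 1 / 4 * (τ * n) + τ * n / 4 := by
        gcongr
        linarith
    _ ≤ Γ.card / 2 := by linarith

end
end

section
/- Let v be a nonconstant real analytic function on 𝕋. Then there exists a constant σ₀ = σ₀(v) > 0 (depending only on v) and ε₁ > 0 such that for every 0 < ε < ε₁ and every E ∈ ℝ, the Lebesgue measure of the set {x ∈ 𝕋 : |v(x) − E| < ε} is strictly less than ε^{σ₀}. -/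
noncomputable section

open MeasureTheory Set Filter Topology

/-- Sublevel set estimate: if the `k`-th derivative of `f` is at least `c` on an interval `I`, then
`{x ∈ I : |f x| < c t ^ k}` has measure at most `4 ^ k * t`. -/
theorem volume_abs_lt_le_of_le_iteratedDeriv (k : ℕ) :
    ∀ {f : ℝ → ℝ}, ContDiff ℝ ⊤ f → ∀ {I : Set ℝ}, Convex ℝ I → ∀ {c t : ℝ}, 0 < c → 0 < t →
      (∀ x ∈ I, c ≤ iteratedDeriv k f x) →
      volume {x ∈ I | |f x| < c * t ^ k} ≤ ENNReal.ofReal (4 ^ k * t) := by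
  induction k with
  | zero =>
    intro f _ I _ c t _ _ h
    have hempty : {x ∈ I | |f x| < c * t ^ 0} = ∅ := by
      ext x
      simp only [mem_ofPred_eq, mem_empty_iff_false, iff_false, not_and, not_lt]
      intro hx
      have := h x hx
      simp only [iteratedDeriv_zero] at this
      simpa using this.trans (le_abs_self _)
    rw [hempty, measure_empty]
    exact zero_le
  | succ k ih =>
    intro f hf I hI c t hc ht h
    set g := iteratedDeriv k f with hg
    have hgd : Differentiable ℝ g := hf.differentiable_iteratedDeriv k (by simp)
    have hg' : ∀ x ∈ I, c ≤ deriv g x := fun x hx ↦ by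
      simpa [hg, iteratedDeriv_succ] using h x hx
    have hmono : MonotoneOn g I :=
      monotoneOn_of_deriv_nonneg hI hgd.continuous.continuousOn hgd.differentiableOn
        fun x hx ↦ hc.le.trans (hg' x (interior_subset hx))
    have hct : 0 < c * t := mul_pos hc ht
    have hpow : c * t ^ (k + 1) = c * t * t ^ k := by ring
    have hhigh : volume {x ∈ {x ∈ I | c * t ≤ g x} | |f x| < c * t * t ^ k} ≤
        ENNReal.ofReal (4 ^ k * t) :=
      ih hf (hmono.convex_ge hI (c * t)) hct ht fun x hx ↦ hx.2
    have hlow : volume {x ∈ {x ∈ I | g x ≤ -(c * t)} | |(-f) x| < c * t * t ^ k} ≤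
        ENNReal.ofReal (4 ^ k * t) := by
      refine ih (f := -f) hf.neg (hmono.convex_le hI (-(c * t))) hct ht fun x hx ↦ ?_
      rw [iteratedDeriv_neg]
      have := hx.2
      linarith
    have hmid : volume {x ∈ I | |g x| < c * t} ≤ ENNReal.ofReal (2 * t) := by
      refine (Real.volume_le_diam _).trans (Metric.ediam_le fun x hx y hy ↦ ?_)
      have key : ∀ x y, x ∈ {x ∈ I | |g x| < c * t} → y ∈ {x ∈ I | |g x| < c * t} → x ≤ y →
          y - x ≤ 2 * t := by
        intro x y hx hy hxy
        have h1 := hI.mul_sub_le_image_sub_of_le_deriv hgd.continuous.continuousOn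
          hgd.differentiableOn (fun z hz ↦ hg' z (interior_subset hz)) x hx.1 y hy.1 hxy
        have h2 := abs_lt.1 hx.2
        have h3 := abs_lt.1 hy.2
        refine le_of_mul_le_mul_left ?_ hc
        linarith
      rw [edist_dist, Real.dist_eq]
      refine ENNReal.ofReal_le_ofReal ?_
      rcases le_total x y with hxy | hxy
      · rw [abs_sub_comm, abs_of_nonneg (sub_nonneg.2 hxy)]
        exact key x y hx hy hxy
      · rw [abs_of_nonneg (sub_nonneg.2 hxy)]
        exact key y x hy hx hxy
    have hcover : {x ∈ I | |f x| < c * t ^ (k + 1)} ⊆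
        ({x ∈ {x ∈ I | c * t ≤ g x} | |f x| < c * t * t ^ k} ∪
          {x ∈ {x ∈ I | g x ≤ -(c * t)} | |(-f) x| < c * t * t ^ k}) ∪
          {x ∈ I | |g x| < c * t} := by
      rintro x ⟨hxI, hx⟩
      rw [hpow] at hx
      rcases lt_or_ge (|g x|) (c * t) with h1 | h1
      · exact Or.inr ⟨hxI, h1⟩
      · rcases le_abs.1 h1 with h2 | h2
        · exact Or.inl (Or.inl ⟨⟨hxI, h2⟩, hx⟩)
        · exact Or.inl (Or.inr ⟨⟨hxI, le_neg.1 h2⟩, by simpa using hx⟩)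
    refine (measure_mono hcover).trans ((measure_union_le _ _).trans ((add_le_add
      ((measure_union_le _ _).trans (add_le_add hhigh hlow)) hmid).trans ?_))
    rw [← ENNReal.ofReal_add (by positivity) (by positivity),
      ← ENNReal.ofReal_add (by positivity) (by positivity)]
    refine ENNReal.ofReal_le_ofReal ?_
    have h4 : (1 : ℝ) ≤ 4 ^ k := one_le_pow₀ (by norm_num)
    rw [pow_succ]
    nlinarith

theorem iteratedDeriv_succ_sub_const (k : ℕ) (f : ℝ → ℝ) (E : ℝ) :
    iteratedDeriv (k + 1) (fun z ↦ f z - E) = iteratedDeriv (k + 1) f := by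
  rw [iteratedDeriv_succ', iteratedDeriv_succ']
  congr 1
  ext z
  simp

/-- A nonconstant real analytic function has a nonzero derivative of positive order at each point. -/
theorem exists_iteratedDeriv_succ_ne_zero {v : ℝ → ℝ} (hva : ∀ x, AnalyticAt ℝ v x)
    (hvnc : ∃ a b, v a ≠ v b) (x : ℝ) : ∃ k : ℕ, iteratedDeriv (k + 1) v x ≠ 0 := by
  by_contra! h
  obtain ⟨a, b, hab⟩ := hvnc
  have hev : v =ᶠ[𝓝 x] fun _ ↦ v x := by
    have han : AnalyticAt ℝ (fun z ↦ v z - v x) x := (hva x).fun_sub analyticAt_const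
    have htop : analyticOrderAt (fun z ↦ v z - v x) x = ⊤ := by
      refine ENat.eq_top_iff_forall_ge.2 fun n ↦
        (natCast_le_analyticOrderAt_iff_iteratedDeriv_eq_zero han).2 fun i _ ↦ ?_
      cases i with
      | zero => simp
      | succ i => rw [iteratedDeriv_succ_sub_const, h]
    filter_upwards [analyticOrderAt_eq_top.1 htop] with z hz using sub_eq_zero.1 hz
  have hconst := AnalyticOnNhd.eq_of_eventuallyEq (fun y _ ↦ hva y)
    (fun y _ ↦ analyticAt_const) hev
  exact hab ((congrFun hconst a).trans (congrFun hconst b).symm)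

/-- The measures of the sublevel sets of `v - E` inside `s` obey a power bound uniform in `E`. -/
def HasUniformSublevelBound (v : ℝ → ℝ) (s : Set ℝ) : Prop :=
  ∃ σ > (0 : ℝ), ∃ C > (0 : ℝ), ∀ ε : ℝ, 0 < ε → ε < 1 → ∀ E : ℝ,
    volume {x ∈ s | |v x - E| < ε} ≤ ENNReal.ofReal (C * ε ^ σ)

theorem HasUniformSublevelBound.mono {v : ℝ → ℝ} {s s' : Set ℝ} (hss' : s ⊆ s')
    (h : HasUniformSublevelBound v s') : HasUniformSublevelBound v s := by
  obtain ⟨σ, hσ, C, hC, H⟩ := h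
  refine ⟨σ, hσ, C, hC, fun ε h0 h1 E ↦ (measure_mono ?_).trans (H ε h0 h1 E)⟩
  exact fun x hx ↦ ⟨hss' hx.1, hx.2⟩

theorem HasUniformSublevelBound.union {v : ℝ → ℝ} {s s' : Set ℝ}
    (h : HasUniformSublevelBound v s) (h' : HasUniformSublevelBound v s') :
    HasUniformSublevelBound v (s ∪ s') := by
  obtain ⟨σ, hσ, C, hC, H⟩ := h
  obtain ⟨σ', hσ', C', hC', H'⟩ := h'
  refine ⟨min σ σ', lt_min hσ hσ', C + C', by positivity, fun ε h0 h1 E ↦ ?_⟩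
  have hsub : {x ∈ s ∪ s' | |v x - E| < ε} ⊆
      {x ∈ s | |v x - E| < ε} ∪ {x ∈ s' | |v x - E| < ε} := by
    rintro x ⟨hx | hx, hxE⟩
    · exact Or.inl ⟨hx, hxE⟩
    · exact Or.inr ⟨hx, hxE⟩
  refine (measure_mono hsub).trans ((measure_union_le _ _).trans
    ((add_le_add (H ε h0 h1 E) (H' ε h0 h1 E)).trans ?_))
  rw [← ENNReal.ofReal_add (by positivity) (by positivity), add_mul]
  refine ENNReal.ofReal_le_ofReal (add_le_add ?_ ?_)
  · exact mul_le_mul_of_nonneg_left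
      (Real.rpow_le_rpow_of_exponent_ge h0 h1.le (min_le_left _ _)) hC.le
  · exact mul_le_mul_of_nonneg_left
      (Real.rpow_le_rpow_of_exponent_ge h0 h1.le (min_le_right _ _)) hC'.le

theorem HasUniformSublevelBound.of_neg {v : ℝ → ℝ} {s : Set ℝ}
    (h : HasUniformSublevelBound (-v) s) : HasUniformSublevelBound v s := by
  obtain ⟨σ, hσ, C, hC, H⟩ := h
  refine ⟨σ, hσ, C, hC, fun ε h0 h1 E ↦ ?_⟩
  convert H ε h0 h1 (-E) using 5 with x
  rw [Pi.neg_apply, neg_sub_neg, abs_sub_comm]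

theorem exists_hasUniformSublevelBound_nhds_of_iteratedDeriv_pos {v : ℝ → ℝ}
    (hv : ContDiff ℝ ⊤ v) {x : ℝ} {k : ℕ} (hk : 0 < iteratedDeriv (k + 1) v x) :
    ∃ U ∈ 𝓝 x, HasUniformSublevelBound v U := by
  set d := iteratedDeriv (k + 1) v x with hd
  have hcont : Continuous (iteratedDeriv (k + 1) v) := hv.continuous_iteratedDeriv _ (by simp)
  obtain ⟨r, hr, hball⟩ := Metric.eventually_nhds_iff_ball.1
    (hcont.continuousAt.eventually_const_lt (half_lt_self hk : d / 2 < iteratedDeriv (k + 1) v x))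
  have hd2 : 0 < d / 2 := half_pos hk
  refine ⟨Metric.ball x r, Metric.ball_mem_nhds x hr, ((k + 1 : ℕ) : ℝ)⁻¹, by positivity,
    4 ^ (k + 1) * ((d / 2)⁻¹) ^ ((k + 1 : ℕ) : ℝ)⁻¹, by positivity, fun ε h0 _ E ↦ ?_⟩
  set t := (ε / (d / 2)) ^ ((k + 1 : ℕ) : ℝ)⁻¹ with ht
  have htpos : 0 < t := by positivity
  have hpow : d / 2 * t ^ (k + 1) = ε := by
    rw [ht, Real.rpow_inv_natCast_pow (by positivity) k.succ_ne_zero]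
    field_simp
  have := volume_abs_lt_le_of_le_iteratedDeriv (k + 1) (f := fun z ↦ v z - E)
    (hv.sub contDiff_const) (convex_ball x r) hd2 htpos
    (fun y hy ↦ by rw [iteratedDeriv_succ_sub_const]; exact (hball y hy).le)
  rw [hpow] at this
  refine this.trans_eq ?_
  rw [ht, div_eq_mul_inv, Real.mul_rpow h0.le (by positivity)]
  ring_nf

/-- **Łojasiewicz inequality.** For a nonconstant real analytic `v` on `𝕋` there is
`σ₀ = σ₀(v) > 0` such that for all sufficiently small `ε > 0` and every `E ∈ ℝ`,
`Leb{x ∈ 𝕋 : |v(x) − E| < ε} < ε^{σ₀}`. -/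
theorem lojasiewicz (v : ℝ → ℝ)
    (hva : ∀ x : ℝ, AnalyticAt ℝ v x)
    (hvper : ∀ x : ℝ, v (x + 1) = v x)
    (hvnc : ∃ a b : ℝ, v a ≠ v b) :
    ∃ σ₀ > (0 : ℝ), ∃ ε₁ > (0 : ℝ), ∀ ε : ℝ, 0 < ε → ε < ε₁ → ∀ E : ℝ,
      MeasureTheory.volume {x ∈ Set.Ico (0 : ℝ) 1 | |v x - E| < ε} <
        ENNReal.ofReal (ε ^ σ₀) := by
  have hv : ContDiff ℝ ⊤ v := contDiff_iff_contDiffAt.2 fun x ↦ (hva x).contDiffAt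
  have hbound : HasUniformSublevelBound v (Icc 0 1) := by
    refine isCompact_Icc.induction_on ?_ (fun _ _ hss' h ↦ h.mono hss') (fun _ _ h h' ↦ h.union h')
      fun x _ ↦ ?_
    · exact ⟨1, one_pos, 1, one_pos, fun ε _ _ E ↦ by simp⟩
    · obtain ⟨k, hk⟩ := exists_iteratedDeriv_succ_ne_zero hva hvnc x
      rcases hk.lt_or_gt with hk | hk
      · obtain ⟨U, hU, h⟩ := exists_hasUniformSublevelBound_nhds_of_iteratedDeriv_pos
          (v := -v) (x := x) (k := k) hv.neg (by rw [iteratedDeriv_neg]; linarith)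
        exact ⟨U, mem_nhdsWithin_of_mem_nhds hU, h.of_neg⟩
      · obtain ⟨U, hU, h⟩ := exists_hasUniformSublevelBound_nhds_of_iteratedDeriv_pos hv hk
        exact ⟨U, mem_nhdsWithin_of_mem_nhds hU, h⟩
  obtain ⟨σ, hσ, C, hC, H⟩ := hbound.mono Ico_subset_Icc_self
  have hlim : Tendsto (fun ε : ℝ ↦ C * ε ^ (σ / 2)) (𝓝 0) (𝓝 0) := by
    have := ((Real.continuousAt_rpow_const 0 (σ / 2) (Or.inr (half_pos hσ).le)).tendsto).const_mul C
    simpa [Real.zero_rpow (half_pos hσ).ne'] using this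
  obtain ⟨δ, hδ, hball⟩ := Metric.eventually_nhds_iff.1 (hlim.eventually_lt_const one_pos)
  refine ⟨σ / 2, half_pos hσ, min δ 1, lt_min hδ one_pos, fun ε h0 h1 E ↦ ?_⟩
  refine (H ε h0 (h1.trans_le (min_le_right _ _)) E).trans_lt ?_
  have hsmall : C * ε ^ (σ / 2) < 1 :=
    hball (by simpa [abs_of_pos h0] using h1.trans_le (min_le_left _ _))
  have hpos : 0 < ε ^ (σ / 2) := Real.rpow_pos_of_pos h0 _
  rw [ENNReal.ofReal_lt_ofReal_iff hpos]
  calc C * ε ^ σ = C * ε ^ (σ / 2) * ε ^ (σ / 2) := by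
        rw [mul_assoc, ← Real.rpow_add h0, add_halves]
    _ < 1 * ε ^ (σ / 2) := mul_lt_mul_of_pos_right hsmall hpos
    _ = ε ^ (σ / 2) := one_mul _

end
end

section
/- Let v be a nonconstant real analytic function on 𝕋. Then there exist σ₁ = σ₁(v) ∈ (0,1) and ε₁ > 0 such that for every 0 < ε ≤ ε₁ and every E ∈ ℝ, ∫_𝕋 log(|v(x) − E| + ε) dx < ∫_𝕋 log|v(x) − E| dx + ε^{σ₁}. -/
noncomputable section
open Set MeasureTheory Filter Topology

/-- The case `0 < f x` of `mul_le_abs_of_le_abs_deriv`. -/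
theorem mul_le_of_pos_of_le_abs_deriv {f : ℝ → ℝ} (hf : ContDiff ℝ 1 f) {x r m : ℝ}
    (hr : 0 < r) (hm : 0 < m) (hpos : 0 < f x) (hne : ∀ t ∈ Icc (x - r) (x + r), f t ≠ 0)
    (hd : ∀ t ∈ Icc (x - r) (x + r), m ≤ |deriv f t|) : m * r ≤ f x := by
  have hdiff : Differentiable ℝ f := hf.differentiable one_ne_zero
  have hcont : Continuous f := hf.continuous
  have hfpos : ∀ t ∈ Icc (x - r) (x + r), 0 < f t := by
    intro t ht
    by_contra! hle
    obtain ⟨z, hz, hz0⟩ := isPreconnected_Icc.intermediate_value ht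
      (show x ∈ Icc (x - r) (x + r) from ⟨by linarith, by linarith⟩) hcont.continuousOn
      ⟨hle, hpos.le⟩
    exact hne z hz hz0
  by_contra! hlt
  obtain ⟨s, hs, hs'⟩ := exists_deriv_eq_slope f (show x - r < x by linarith)
    hcont.continuousOn hdiff.differentiableOn
  obtain ⟨t, ht, ht'⟩ := exists_deriv_eq_slope f (show x < x + r by linarith)
    hcont.continuousOn hdiff.differentiableOn
  have hsI : s ∈ Icc (x - r) (x + r) := ⟨hs.1.le, by linarith [hs.2]⟩
  have htI : t ∈ Icc (x - r) (x + r) := ⟨by linarith [ht.1], ht.2.le⟩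
  have hsneg : deriv f s ≤ 0 := by
    by_contra! h
    have h1 := hd s hsI
    rw [abs_of_pos h, hs', sub_sub_cancel, le_div_iff₀ hr] at h1
    linarith [hfpos (x - r) ⟨le_rfl, by linarith⟩]
  have htpos : 0 ≤ deriv f t := by
    by_contra! h
    have h1 := hd t htI
    rw [abs_of_neg h, ht', add_sub_cancel_left, ← neg_div, le_div_iff₀ hr] at h1
    linarith [hfpos (x + r) ⟨by linarith, le_rfl⟩]
  obtain ⟨z, hz, hz0⟩ := isPreconnected_Icc.intermediate_value hsI htI
    (hf.continuous_deriv le_rfl).continuousOn ⟨hsneg, htpos⟩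
  have := hd z hz
  rw [hz0, abs_zero] at this
  linarith

/-- If `f` has no zero and `|f'| ≥ m` within distance `r` of `x`, then `|f x| ≥ m * r`. -/
theorem mul_le_abs_of_le_abs_deriv {f : ℝ → ℝ} (hf : ContDiff ℝ 1 f) {x r m : ℝ}
    (hr : 0 < r) (hm : 0 < m) (hne : ∀ t ∈ Icc (x - r) (x + r), f t ≠ 0)
    (hd : ∀ t ∈ Icc (x - r) (x + r), m ≤ |deriv f t|) : m * r ≤ |f x| := by
  rcases (hne x ⟨by linarith, by linarith⟩).lt_or_gt with h | h
  · rw [abs_of_neg h]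
    refine mul_le_of_pos_of_le_abs_deriv hf.neg hr hm (neg_pos.2 h)
      (fun t ht => neg_ne_zero.2 (hne t ht)) fun t ht => ?_
    simpa [deriv.neg'] using hd t ht
  · rw [abs_of_pos h]
    exact mul_le_of_pos_of_le_abs_deriv hf hr hm h hne hd

/-- A **Łojasiewicz inequality** on `[0, 1]`. -/
theorem exists_finset_mul_abs_sub_pow_le {g : ℝ → ℝ} (hg : ∀ x, AnalyticAt ℝ g x)
    (hg0 : ∃ x, g x ≠ 0) :
    ∃ (F : Finset ℝ) (c : ℝ) (k : ℕ), 0 < c ∧ (∀ p ∈ F, p ∈ Icc (0 : ℝ) 1) ∧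
      ∀ x ∈ Icc (0 : ℝ) 1, ∃ p ∈ F, c * |x - p| ^ k ≤ |g x| := by
  classical
  suffices h : ∃ (F : Finset ℝ) (c : ℝ) (k : ℕ), 0 < c ∧ (∀ p ∈ F, p ∈ Icc (0 : ℝ) 1) ∧
      ∀ x ∈ Icc (0 : ℝ) 1, x ∈ Icc (0 : ℝ) 1 → ∃ p ∈ F, c * |x - p| ^ k ≤ |g x| by
    obtain ⟨F, c, k, hc, hF, h⟩ := h
    exact ⟨F, c, k, hc, hF, fun x hx => h x hx hx⟩
  refine isCompact_Icc.induction_on (p := fun S => ∃ (F : Finset ℝ) (c : ℝ) (k : ℕ), 0 < c ∧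
    (∀ p ∈ F, p ∈ Icc (0 : ℝ) 1) ∧
      ∀ x ∈ S, x ∈ Icc (0 : ℝ) 1 → ∃ p ∈ F, c * |x - p| ^ k ≤ |g x|) ?_ ?_ ?_ ?_
  · exact ⟨∅, 1, 0, one_pos, by simp, by simp⟩
  · rintro S T hST ⟨F, c, k, hc, hF, h⟩
    exact ⟨F, c, k, hc, hF, fun x hx => h x (hST hx)⟩
  · rintro S T ⟨F, c, k, hc, hF, h⟩ ⟨F', c', k', hc', hF', h'⟩
    have key : ∀ x ∈ Icc (0 : ℝ) 1, ∀ p ∈ Icc (0 : ℝ) 1, |x - p| ≤ 1 := fun x hx p hp =>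
      abs_le.2 ⟨by linarith [hx.1, hp.2], by linarith [hx.2, hp.1]⟩
    refine ⟨F ∪ F', min c c', max k k', lt_min hc hc', ?_, ?_⟩
    · intro p hp
      rcases Finset.mem_union.1 hp with hp | hp
      exacts [hF p hp, hF' p hp]
    · rintro x (hx | hx) hx1
      · obtain ⟨p, hp, hle⟩ := h x hx hx1
        refine ⟨p, Finset.mem_union_left _ hp, le_trans ?_ hle⟩
        exact mul_le_mul (min_le_left _ _) (pow_le_pow_of_le_one (abs_nonneg _)
          (key x hx1 p (hF p hp)) (le_max_left _ _)) (by positivity) hc.le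
      · obtain ⟨p, hp, hle⟩ := h' x hx hx1
        refine ⟨p, Finset.mem_union_right _ hp, le_trans ?_ hle⟩
        exact mul_le_mul (min_le_right _ _) (pow_le_pow_of_le_one (abs_nonneg _)
          (key x hx1 p (hF' p hp)) (le_max_right _ _)) (by positivity) hc'.le
  · intro x hx
    have hnz : ¬ ∀ᶠ z in 𝓝 x, g z = 0 := by
      intro h
      obtain ⟨y, hy⟩ := hg0
      have hgn : AnalyticOnNhd ℝ g univ := fun z _ => hg z
      exact hy (hgn.eqOn_zero_of_preconnected_of_eventuallyEq_zero isPreconnected_univ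
        (mem_univ x) h (mem_univ y))
    obtain ⟨n, h, hh, hh0, heq⟩ := (hg x).exists_eventuallyEq_pow_smul_nonzero_iff.2 hnz
    have hlt : ∀ᶠ z in 𝓝 x, |h x| / 2 < |h z| :=
      (hh.continuousAt.abs).eventually_const_lt (half_lt_self (abs_pos.2 hh0))
    refine ⟨{z | |h x| / 2 * |z - x| ^ n ≤ |g z|}, mem_nhdsWithin_of_mem_nhds ?_,
      {x}, |h x| / 2, n, by positivity, by simpa using hx, fun z hz _ => ⟨x, by simp, hz⟩⟩
    filter_upwards [heq, hlt] with z hz hz'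
    rw [hz, smul_eq_mul, abs_mul, abs_pow, mul_comm]
    gcongr

/-- The number of zeros of `f` exceeds that of its derivative by at most one. -/
theorem finite_zeros_card_le {f : ℝ → ℝ} (hf : Continuous f) {I : Set ℝ} (hI : I.OrdConnected)
    {F : Finset ℝ} (hF : ∀ x ∈ I, deriv f x = 0 → x ∈ F) :
    ∃ Z : Finset ℝ, (∀ x, x ∈ Z ↔ x ∈ I ∧ f x = 0) ∧ Z.card ≤ F.card + 1 := by
  have key : ∀ Z : Finset ℝ, (∀ x ∈ Z, x ∈ I ∧ f x = 0) → Z.card ≤ F.card + 1 := by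
    refine fun Z hZ => Finset.card_le_of_interleaved fun x hx y hy hxy _ => ?_
    obtain ⟨z, hz, hz0⟩ := exists_deriv_eq_zero hxy hf.continuousOn
      ((hZ x hx).2.trans (hZ y hy).2.symm)
    exact ⟨z, hF z (hI.out (hZ x hx).1 (hZ y hy).1 ⟨hz.1.le, hz.2.le⟩) hz0, hz.1, hz.2⟩
  have hfin : {x | x ∈ I ∧ f x = 0}.Finite := by
    by_contra hinf
    obtain ⟨t, ht, hcard⟩ := Set.Infinite.exists_subset_card_eq hinf (F.card + 2)
    have := key t fun x hx => ht hx
    omega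
  exact ⟨hfin.toFinset, by simp, key _ (by simp)⟩

/-- Pointwise lower bound for `f` in terms of one for its derivative. -/
theorem exists_finset_mul_abs_sub_half_pow_le {f : ℝ → ℝ} (hf : ContDiff ℝ 1 f)
    {F : Finset ℝ} {c : ℝ} {k : ℕ} (hc : 0 < c) (hF : ∀ p ∈ F, p ∈ Icc (0 : ℝ) 1)
    (h : ∀ x ∈ Icc (0 : ℝ) 1, ∃ p ∈ F, c * |x - p| ^ k ≤ |deriv f x|) :
    ∃ G : Finset ℝ, G.card ≤ 2 * F.card + 3 ∧ (∀ p ∈ G, p ∈ Icc (0 : ℝ) 1) ∧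
      ∀ x ∈ Icc (0 : ℝ) 1, ∃ q ∈ G, c * (|x - q| / 2) ^ (k + 1) ≤ |f x| := by
  classical
  obtain ⟨Z, hZ, hZc⟩ := finite_zeros_card_le hf.continuous (I := Icc 0 1) ordConnected_Icc
    (F := F) (by
      intro x hx h0
      obtain ⟨p, hp, hle⟩ := h x hx
      rw [h0, abs_zero] at hle
      have h1 : |x - p| ^ k ≤ 0 := by
        by_contra! h1
        have := mul_pos hc h1
        linarith
      have h2 : |x - p| = 0 := eq_zero_of_pow_eq_zero (le_antisymm h1 (by positivity))
      rwa [sub_eq_zero.1 (abs_eq_zero.1 h2)])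
  refine ⟨insert 0 (insert 1 (F ∪ Z)), ?_, ?_, ?_⟩
  · have h1 := Finset.card_insert_le (0 : ℝ) (insert 1 (F ∪ Z))
    have h2 := Finset.card_insert_le (1 : ℝ) (F ∪ Z)
    have h3 := Finset.card_union_le F Z
    omega
  · intro p hp
    simp only [Finset.mem_insert, Finset.mem_union] at hp
    rcases hp with rfl | rfl | hp | hp
    · simp
    · simp
    · exact hF p hp
    · exact ((hZ p).1 hp).1
  · intro x hx
    obtain ⟨q, hq, hmin⟩ := Finset.exists_min_image (insert 0 (insert 1 (F ∪ Z)))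
      (fun q => |x - q|) ⟨0, by simp⟩
    refine ⟨q, hq, ?_⟩
    set d := |x - q| with hd
    rcases (abs_nonneg (x - q)).eq_or_lt with h0 | hpos
    · rw [hd, ← h0]
      simp
    rw [← hd] at hpos
    have hd0 : d ≤ x := by simpa [abs_of_nonneg hx.1] using hmin 0 (by simp)
    have hd1 : d ≤ 1 - x := by
      simpa [abs_of_nonpos (sub_nonpos.2 hx.2)] using hmin 1 (by simp)
    rw [pow_succ, ← mul_assoc]
    refine mul_le_abs_of_le_abs_deriv hf (by positivity) (by positivity) ?_ ?_
    · intro t ht h0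
      have htZ : t ∈ Z := (hZ t).2 ⟨⟨by linarith [ht.1], by linarith [ht.2]⟩, h0⟩
      have h1 := hmin t (by simp [htZ])
      have h2 : |x - t| ≤ d / 2 := abs_le.2 ⟨by linarith [ht.2], by linarith [ht.1]⟩
      linarith
    · intro t ht
      obtain ⟨p, hp, hle⟩ := h t ⟨by linarith [ht.1], by linarith [ht.2]⟩
      refine le_trans ?_ hle
      have h1 := hmin p (by simp [hp])
      have h2 : |x - t| ≤ d / 2 := abs_le.2 ⟨by linarith [ht.2], by linarith [ht.1]⟩
      have h3 := abs_sub_le x t p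
      gcongr
      linarith

theorem intervalIntegrable_abs_rpow {r : ℝ} (hr : -1 < r) (a b : ℝ) :
    IntervalIntegrable (fun x : ℝ => |x| ^ r) volume a b := by
  have h : ∀ c : ℝ, 0 < c → IntervalIntegrable (fun x : ℝ => |x| ^ r) volume 0 c := by
    intro c hc
    refine (intervalIntegral.intervalIntegrable_rpow' hr).congr ?_
    intro x hx
    rw [uIoc_of_le hc.le] at hx
    simp [abs_of_pos hx.1]
  exact intervalIntegrable_of_even (fun x => by rw [abs_neg]) h
    (by simp [enorm_ne_top]) (by simp [enorm_ne_top])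

theorem log_add_sub_log_le {a ε s : ℝ} (ha : 0 < a) (hε : 0 < ε) (hs : 0 < s) (hs1 : s ≤ 1) :
    Real.log (a + ε) - Real.log a ≤ (ε / a) ^ s / s := by
  have hy : 0 < ε / a := div_pos hε ha
  rw [← Real.log_div (by positivity) ha.ne', add_div, div_self ha.ne', le_div_iff₀ hs, mul_comm,
    ← Real.log_rpow (by positivity)]
  have h1 := Real.rpow_add_le_add_rpow zero_le_one hy.le hs.le hs1
  rw [Real.one_rpow] at h1
  have h2 := Real.log_le_sub_one_of_pos (x := (1 + ε / a) ^ s) (by positivity)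
  linarith

theorem log_add_sub_log_le_of_mul_half_pow_le {a c y ε : ℝ} {m : ℕ} (hm : 0 < m) (hc : 0 < c)
    (hy : 0 < y) (hε : 0 < ε) (h : c * (y / 2) ^ m ≤ a) :
    Real.log (a + ε) - Real.log a ≤
      ε ^ (1 / (2 * m) : ℝ) * (2 * m * c ^ (-(1 / (2 * m)) : ℝ) * 2 ^ (1 / 2 : ℝ)) *
        y ^ (-1 / 2 : ℝ) := by
  have hm1 : (1 : ℝ) ≤ m := by exact_mod_cast hm
  set s : ℝ := 1 / (2 * m) with hs
  have hs0 : 0 < s := by positivity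
  have hs1 : s ≤ 1 := by
    rw [hs, div_le_one (by positivity)]
    linarith
  have hb : 0 < c * (y / 2) ^ m := by positivity
  have hms : (m : ℝ) * s = 1 / 2 := by
    rw [hs]
    field_simp
  have hsinv : s⁻¹ = 2 * m := by rw [hs, one_div, inv_inv]
  calc Real.log (a + ε) - Real.log a ≤ (ε / a) ^ s / s :=
        log_add_sub_log_le (hb.trans_le h) hε hs0 hs1
    _ ≤ (ε / (c * (y / 2) ^ m)) ^ s / s := by
        have := hb.trans_le h
        gcongr
    _ = _ := by
        rw [Real.div_rpow hε.le hb.le, Real.mul_rpow hc.le (by positivity), ← Real.rpow_natCast,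
          ← Real.rpow_mul (by positivity), hms, Real.div_rpow hy.le zero_le_two,
          Real.rpow_neg hc.le, neg_div, Real.rpow_neg hy.le, div_eq_mul_inv _ s, hsinv]
        have := Real.rpow_pos_of_pos hy (1 / 2)
        have := Real.rpow_pos_of_pos hc s
        field_simp

theorem integral_abs_sub_rpow_le {q : ℝ} (hq : q ∈ Icc (0 : ℝ) 1) :
    ∫ x in (0 : ℝ)..1, |x - q| ^ (-1 / 2 : ℝ) ≤ ∫ x in (-1 : ℝ)..1, |x| ^ (-1 / 2 : ℝ) := by
  rw [intervalIntegral.integral_comp_sub_right fun x => |x| ^ (-1 / 2 : ℝ)]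
  exact intervalIntegral.integral_mono_interval (by linarith [hq.2]) (by linarith)
    (by linarith [hq.1]) (ae_of_all _ fun x => by positivity)
    (intervalIntegrable_abs_rpow (by norm_num) _ _)

/-- The perturbation estimate for a function bounded below by a power of the distance to a
finite set. -/
theorem integral_log_add_le {f : ℝ → ℝ} (hf : ∀ x, AnalyticAt ℝ f x) {G : Finset ℝ} {c ε : ℝ}
    {m : ℕ} (hm : 0 < m) (hc : 0 < c) (hε : 0 < ε) (hG : ∀ p ∈ G, p ∈ Icc (0 : ℝ) 1)
    (h : ∀ x ∈ Icc (0 : ℝ) 1, ∃ q ∈ G, c * (|x - q| / 2) ^ m ≤ |f x|) :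
    ∫ x in (0 : ℝ)..1, Real.log (|f x| + ε) ≤ (∫ x in (0 : ℝ)..1, Real.log |f x|) +
      ε ^ (1 / (2 * m) : ℝ) * (2 * m * c ^ (-(1 / (2 * m)) : ℝ) * 2 ^ (1 / 2 : ℝ)) *
        (G.card * ∫ x in (-1 : ℝ)..1, |x| ^ (-1 / 2 : ℝ)) := by
  set A : ℝ := ε ^ (1 / (2 * m) : ℝ) * (2 * m * c ^ (-(1 / (2 * m)) : ℝ) * 2 ^ (1 / 2 : ℝ))
    with hA
  have hA0 : 0 ≤ A := by positivity
  have hcont : Continuous f := continuous_iff_continuousAt.2 fun x => (hf x).continuousAt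
  have hint1 : IntervalIntegrable (fun x => Real.log (|f x| + ε)) volume 0 1 :=
    (Continuous.log (by fun_prop) fun x => by positivity).intervalIntegrable _ _
  have hint2 : IntervalIntegrable (fun x => Real.log |f x|) volume 0 1 :=
    MeromorphicOn.intervalIntegrable_log_norm fun x _ => (hf x).meromorphicAt
  have hint3 : ∀ q ∈ G, IntervalIntegrable (fun x => |x - q| ^ (-1 / 2 : ℝ)) volume 0 1 := by
    intro q _
    simpa using (intervalIntegrable_abs_rpow (r := -1 / 2) (by norm_num) (0 - q) (1 - q)
      ).comp_sub_right q (by simp [enorm_ne_top])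
  have hint4 : IntervalIntegrable (fun x => ∑ q ∈ G, |x - q| ^ (-1 / 2 : ℝ)) volume 0 1 := by
    simpa only [Finset.sum_fn] using IntervalIntegrable.sum G hint3
  have hle : ∫ x in (0 : ℝ)..1, Real.log (|f x| + ε) ≤
      ∫ x in (0 : ℝ)..1, (Real.log |f x| + A * ∑ q ∈ G, |x - q| ^ (-1 / 2 : ℝ)) := by
    refine intervalIntegral.integral_mono_ae_restrict zero_le_one hint1
      (hint2.add (hint4.const_mul A)) ?_
    have hnot : ∀ᵐ x ∂(volume.restrict (Icc (0 : ℝ) 1)), x ∉ (G : Set ℝ) :=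
      ae_restrict_of_ae (G.finite_toSet.countable.ae_notMem _)
    filter_upwards [hnot, ae_restrict_mem measurableSet_Icc] with x hxG hx
    obtain ⟨q, hq, hle⟩ := h x hx
    have hpos : 0 < |x - q| := abs_pos.2 (sub_ne_zero.2 fun e => hxG (e ▸ hq))
    have h1 := log_add_sub_log_le_of_mul_half_pow_le hm hc hpos hε hle
    rw [← hA] at h1
    have h2 : |x - q| ^ (-1 / 2 : ℝ) ≤ ∑ q ∈ G, |x - q| ^ (-1 / 2 : ℝ) :=
      Finset.single_le_sum (f := fun q => |x - q| ^ (-1 / 2 : ℝ))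
        (fun q _ => by positivity) hq
    have h3 := mul_le_mul_of_nonneg_left h2 hA0
    linarith
  refine hle.trans ?_
  rw [intervalIntegral.integral_add hint2 (hint4.const_mul A),
    intervalIntegral.integral_const_mul, intervalIntegral.integral_finsetSum hint3]
  gcongr
  rw [← nsmul_eq_mul]
  exact Finset.sum_le_card_nsmul _ _ _ fun q hq => integral_abs_sub_rpow_le (hG q hq)

/-- **Lemma.** For a nonconstant real analytic `v` on `𝕋` there are `σ₁ = σ₁(v) ∈ (0,1)`
and `ε₁ > 0` such that for `0 < ε ≤ ε₁` and every `E ∈ ℝ`,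
`∫_𝕋 log(|v(x) − E| + ε) dx < ∫_𝕋 log|v(x) − E| dx + ε^{σ₁}`. -/
theorem log_integral_perturbation (v : ℝ → ℝ)
    (hva : ∀ x : ℝ, AnalyticAt ℝ v x)
    (hvper : ∀ x : ℝ, v (x + 1) = v x)
    (hvnc : ∃ a b : ℝ, v a ≠ v b) :
    ∃ σ₁ ∈ Set.Ioo (0 : ℝ) 1, ∃ ε₁ > (0 : ℝ), ∀ ε : ℝ, 0 < ε → ε ≤ ε₁ → ∀ E : ℝ,
      (∫ x in (0 : ℝ)..1, Real.log (|v x - E| + ε)) <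
        (∫ x in (0 : ℝ)..1, Real.log |v x - E|) + ε ^ σ₁ := by
  obtain ⟨F, c, k, hc, hF, hFle⟩ := exists_finset_mul_abs_sub_pow_le (g := deriv v)
    (fun x => (hva x).deriv) (by
      by_contra! h
      obtain ⟨a, b, hab⟩ := hvnc
      exact hab (is_const_of_deriv_eq_zero (fun x => (hva x).differentiableAt) h a b))
  set m : ℕ := k + 1 with hm
  have hm1 : (1 : ℝ) ≤ m := by simp [hm]
  set s : ℝ := 1 / (2 * m) with hs
  have hs0 : 0 < s := by positivity
  have hs1 : s ≤ 1 := by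
    rw [hs, div_le_one (by positivity)]
    linarith
  set K : ℝ := ∫ x in (-1 : ℝ)..1, |x| ^ (-1 / 2 : ℝ) with hK
  have hK0 : 0 ≤ K := intervalIntegral.integral_nonneg (by norm_num) fun x _ => by positivity
  set B : ℝ := 2 * m * c ^ (-s) * 2 ^ (1 / 2 : ℝ) with hB
  have hB0 : 0 ≤ B := by positivity
  set D : ℝ := B * ((2 * F.card + 3 : ℕ) * K) with hD
  have hD0 : 0 ≤ D := by positivity
  refine ⟨s / 2, ⟨by linarith, by linarith⟩, (D + 1)⁻¹ ^ (2 / s), by positivity, ?_⟩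
  intro ε hε hε1 E
  have hfa : ∀ x, AnalyticAt ℝ (fun x => v x - E) x := fun x => (hva x).sub analyticAt_const
  obtain ⟨G, hGc, hG, hGle⟩ := exists_finset_mul_abs_sub_half_pow_le
    (f := fun x => v x - E) (contDiff_iff_contDiffAt.2 fun x => (hfa x).contDiffAt) hc hF
    (by simpa using hFle)
  have hmain := integral_log_add_le hfa (Nat.succ_pos k) hc hε hG hGle
  simp only [Nat.succ_eq_add_one, ← hm, ← hs, ← hK, ← hB] at hmain
  refine hmain.trans_lt (by
    gcongr
    have hcard : B * (G.card * K) ≤ D := by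
      rw [hD]
      gcongr
    have hhalf : ε ^ (s / 2) ≤ (D + 1)⁻¹ := by
      calc ε ^ (s / 2) ≤ ((D + 1)⁻¹ ^ (2 / s)) ^ (s / 2) := by gcongr
        _ = (D + 1)⁻¹ := by
          rw [← Real.rpow_mul (by positivity), show 2 / s * (s / 2) = 1 by field_simp,
            Real.rpow_one]
    have hsq : ε ^ s = ε ^ (s / 2) * ε ^ (s / 2) := by rw [← Real.rpow_add hε, add_halves]
    have hp : 0 < ε ^ (s / 2) := by positivity
    calc ε ^ s * B * (G.card * K) = ε ^ (s / 2) * (ε ^ (s / 2) * (B * (G.card * K))) := by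
          rw [hsq]
          ring
      _ ≤ ε ^ (s / 2) * ((D + 1)⁻¹ * D) := by gcongr
      _ < ε ^ (s / 2) * 1 := by
          gcongr
          rw [inv_mul_lt_iff₀ (by positivity)]
          linarith
      _ = ε ^ (s / 2) := mul_one _)

end
end

section
/- Let v be a nonconstant real analytic function on 𝕋. Then there exists σ₀ = σ₀(v) > 0 such that for every 0 < σ₂ < σ₀ there is a constant C = C(σ₂, v) > 0 with ∫_𝕋 |v(x) − E|^{−σ₂} dx ≤ C for every E ∈ ℝ. -/
noncomputable section

open Set Filter Topology MeasureTheory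

/-- A lower bound `c (t - a) ^ m` on the derivative gives a power lower bound on increments. -/
lemma mul_pow_le_sub_of_le_deriv {f : ℝ → ℝ} (hf : Differentiable ℝ f) {a r c : ℝ} {m : ℕ}
    (hc : 0 ≤ c) (h : ∀ t ∈ Icc a (a + r), c * (t - a) ^ m ≤ deriv f t)
    {x y : ℝ} (hx : x ∈ Icc a (a + r)) (hy : y ∈ Icc a (a + r)) (hxy : x ≤ y) :
    c / (m + 1) * (y - x) ^ (m + 1) ≤ f y - f x := by
  have hd : ∀ t : ℝ, HasDerivAt (fun t ↦ f t - c / (m + 1) * (t - a) ^ (m + 1))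
      (deriv f t - c * (t - a) ^ m) t := by
    intro t
    have h1 := (((hasDerivAt_id t).sub_const a).pow (m + 1)).const_mul (c / (m + 1))
    refine ((hf t).hasDerivAt.sub h1).congr_deriv ?_
    have hm : (m : ℝ) + 1 ≠ 0 := by positivity
    simp
    field_simp
  have hmono : MonotoneOn (fun t ↦ f t - c / (m + 1) * (t - a) ^ (m + 1)) (Icc a (a + r)) := by
    refine monotoneOn_of_deriv_nonneg (convex_Icc _ _)
      (fun t _ ↦ (hd t).continuousAt.continuousWithinAt)
      (fun t _ ↦ (hd t).differentiableAt.differentiableWithinAt) fun t ht ↦ ?_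
    rw [(hd t).deriv]
    exact sub_nonneg.2 (h t (interior_subset ht))
  have h1 := hmono hx hy hxy
  have h2 : (y - x) ^ (m + 1) + (x - a) ^ (m + 1) ≤ (y - a) ^ (m + 1) := by
    have := pow_add_pow_le (sub_nonneg.2 hxy) (sub_nonneg.2 hx.1) m.succ_ne_zero
    simpa using this
  have h3 := mul_le_mul_of_nonneg_left h2 (show 0 ≤ c / ((m : ℝ) + 1) by positivity)
  simp only at h1
  linarith

/-- The derivative of a nonconstant analytic function on `ℝ` vanishes to finite order. -/
lemma not_eventually_deriv_eq_zero {v : ℝ → ℝ} (hva : ∀ x, AnalyticAt ℝ v x)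
    (hvnc : ∃ a b : ℝ, v a ≠ v b) (x₀ : ℝ) : ¬ ∀ᶠ z in 𝓝 x₀, deriv v z = 0 := by
  intro h
  obtain ⟨a, b, hab⟩ := hvnc
  have han : AnalyticOnNhd ℝ (deriv v) univ := fun x _ ↦ (hva x).deriv
  have h0 := han.eqOn_zero_of_preconnected_of_eventuallyEq_zero isPreconnected_univ
    (mem_univ x₀) h
  exact hab (is_const_of_deriv_eq_zero (fun x ↦ (hva x).differentiableAt)
    (fun x ↦ h0 (mem_univ x)) a b)

/-- A nonconstant analytic function expands distances at least like a power, to the right of any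
given point. -/
lemma exists_pow_le_abs_sub_right {v : ℝ → ℝ} (hva : ∀ x, AnalyticAt ℝ v x)
    (hvnc : ∃ a b : ℝ, v a ≠ v b) (x₀ : ℝ) :
    ∃ r > (0 : ℝ), ∃ c > (0 : ℝ), ∃ n : ℕ, ∀ x ∈ Icc x₀ (x₀ + r), ∀ y ∈ Icc x₀ (x₀ + r),
      c * |x - y| ^ n ≤ |v x - v y| := by
  have hdiff : Differentiable ℝ v := fun x ↦ (hva x).differentiableAt
  obtain ⟨m, g, hg, hg0, hgv⟩ := (hva x₀).deriv.exists_eventuallyEq_pow_smul_nonzero_iff.2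
    (not_eventually_deriv_eq_zero hva hvnc x₀)
  obtain ⟨s, hs, hsg⟩ : ∃ s : ℝ, |s| = 1 ∧ s * g x₀ = |g x₀| := by
    rcases lt_or_gt_of_ne hg0 with h | h
    · exact ⟨-1, by simp, by rw [abs_of_neg h]; ring⟩
    · exact ⟨1, by simp, by rw [abs_of_pos h]; ring⟩
  have hpos : 0 < |g x₀| := abs_pos.2 hg0
  have hev : ∀ᶠ z in 𝓝 x₀, |g x₀| / 2 < s * g z :=
    (hg.continuousAt.const_mul s).eventually_const_lt (by linarith)
  obtain ⟨ε, hε, hball⟩ := Metric.eventually_nhds_iff.1 (hev.and hgv)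
  have hder : ∀ t ∈ Icc x₀ (x₀ + ε / 2),
      |g x₀| / 2 * (t - x₀) ^ m ≤ deriv (fun t ↦ s * v t) t := by
    intro t ht
    obtain ⟨h1, h2⟩ := hball (y := t) (by
      rw [Real.dist_eq, abs_of_nonneg (sub_nonneg.2 ht.1)]; linarith [ht.2])
    rw [deriv_const_mul _ (hdiff t), h2, smul_eq_mul]
    have := mul_le_mul_of_nonneg_right h1.le (pow_nonneg (sub_nonneg.2 ht.1) m)
    linarith
  have key : ∀ x ∈ Icc x₀ (x₀ + ε / 2), ∀ y ∈ Icc x₀ (x₀ + ε / 2), x ≤ y →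
      |g x₀| / 2 / (m + 1) * |x - y| ^ (m + 1) ≤ |v x - v y| := by
    intro x hx y hy hxy
    have := mul_pow_le_sub_of_le_deriv (hdiff.const_mul s) (by positivity) hder hx hy hxy
    rw [abs_sub_comm x y, abs_of_nonneg (sub_nonneg.2 hxy), abs_sub_comm (v x)]
    calc _ ≤ s * v y - s * v x := this
      _ ≤ |s * (v y - v x)| := by rw [← mul_sub]; exact le_abs_self _
      _ = |v y - v x| := by rw [abs_mul, hs, one_mul]
  refine ⟨ε / 2, by positivity, |g x₀| / 2 / (m + 1), by positivity, m + 1,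
    fun x hx y hy ↦ ?_⟩
  rcases le_total x y with h | h
  · exact key x hx y hy h
  · rw [abs_sub_comm x y, abs_sub_comm (v x)]
    exact key y hy x hx h

/-- Left-sided version of `exists_pow_le_abs_sub_right`. -/
lemma exists_pow_le_abs_sub_left {v : ℝ → ℝ} (hva : ∀ x, AnalyticAt ℝ v x)
    (hvnc : ∃ a b : ℝ, v a ≠ v b) (x₀ : ℝ) :
    ∃ r > (0 : ℝ), ∃ c > (0 : ℝ), ∃ n : ℕ, ∀ x ∈ Icc (x₀ - r) x₀, ∀ y ∈ Icc (x₀ - r) x₀,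
      c * |x - y| ^ n ≤ |v x - v y| := by
  obtain ⟨a, b, hab⟩ := hvnc
  obtain ⟨r, hr, c, hc, n, h⟩ := exists_pow_le_abs_sub_right (v := fun x ↦ v (-x))
    (fun x ↦ (hva (-x)).comp analyticAt_id.neg) ⟨-a, -b, by simpa using hab⟩ (-x₀)
  refine ⟨r, hr, c, hc, n, fun x hx y hy ↦ ?_⟩
  have := h (-x) ⟨by linarith [hx.2], by linarith [hx.1]⟩ (-y)
    ⟨by linarith [hy.2], by linarith [hy.1]⟩
  rwa [neg_neg, neg_neg, neg_sub_neg, abs_sub_comm y x] at this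

/-- `|v - E| ^ (-σ)` has bounded integral over `s`, uniformly in `E`, for all small `σ > 0`. -/
def UniformNegPowerBound (v : ℝ → ℝ) (s : Set ℝ) : Prop :=
  ∃ σ₀ > (0 : ℝ), ∀ σ : ℝ, 0 < σ → σ < σ₀ → ∃ C : NNReal, ∀ E : ℝ,
    ∫⁻ x in s, ENNReal.ofReal (|v x - E| ^ (-σ)) ≤ C

lemma UniformNegPowerBound.mono {v : ℝ → ℝ} {s t : Set ℝ} (hst : s ⊆ t)
    (h : UniformNegPowerBound v t) : UniformNegPowerBound v s := by
  obtain ⟨σ₀, hσ₀, h⟩ := h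
  refine ⟨σ₀, hσ₀, fun σ h0 h1 ↦ ?_⟩
  obtain ⟨C, hC⟩ := h σ h0 h1
  exact ⟨C, fun E ↦ (lintegral_mono_set hst).trans (hC E)⟩

lemma UniformNegPowerBound.union {v : ℝ → ℝ} {s t : Set ℝ}
    (hs : UniformNegPowerBound v s) (ht : UniformNegPowerBound v t) :
    UniformNegPowerBound v (s ∪ t) := by
  obtain ⟨σ₁, hσ₁, hs⟩ := hs
  obtain ⟨σ₂, hσ₂, ht⟩ := ht
  refine ⟨min σ₁ σ₂, lt_min hσ₁ hσ₂, fun σ h0 h1 ↦ ?_⟩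
  obtain ⟨C, hC⟩ := hs σ h0 (h1.trans_le (min_le_left _ _))
  obtain ⟨D, hD⟩ := ht σ h0 (h1.trans_le (min_le_right _ _))
  refine ⟨C + D, fun E ↦ (lintegral_union_le _ _ _).trans ?_⟩
  push_cast
  exact add_le_add (hC E) (hD E)

lemma lintegral_Icc_abs_rpow_lt_top {K α : ℝ} (hα : α < 1) (L : ℝ) :
    ∫⁻ t in Icc (-L) L, ENNReal.ofReal (K * |t| ^ (-α)) < ⊤ := by
  have hloc : LocallyIntegrable (fun t : ℝ ↦ K * |t| ^ (-α)) := by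
    refine locallyIntegrable_of_norm_le_rpow (C := |K|) (α := α) (by simp) (by simpa using hα)
      (ae_of_all _ fun t ↦ ?_)
      ((measurable_id.norm.pow_const _).const_mul K).aestronglyMeasurable
    rw [norm_mul, Real.norm_eq_abs, Real.norm_eq_abs, Real.norm_eq_abs,
      abs_of_nonneg (Real.rpow_nonneg (abs_nonneg t) _)]
  exact (hloc.integrableOn_isCompact isCompact_Icc).lintegral_lt_top

/-- If `v` expands distances on `[p, q]` at least like a power, then negative powers of `v - E`
are uniformly integrable on `[p, q]`. -/
lemma UniformNegPowerBound.of_pow_le_abs_sub {v : ℝ → ℝ} (hv : Continuous v) {p q c : ℝ}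
    (hpq : p ≤ q) (hc : 0 < c) {n : ℕ}
    (h : ∀ x ∈ Icc p q, ∀ y ∈ Icc p q, c * |x - y| ^ n ≤ |v x - v y|) :
    UniformNegPowerBound v (Icc p q) := by
  refine ⟨1 / (n + 1), by positivity, fun σ h0 h1 ↦ ?_⟩
  have hα : n * σ < 1 := by
    rw [lt_div_iff₀ (by positivity)] at h1
    nlinarith
  set F : ℝ → ENNReal := (Icc (-(q - p)) (q - p)).indicator
    fun t ↦ ENNReal.ofReal ((c / 2) ^ (-σ) * |t| ^ (-(n * σ))) with hF
  have hfin : ∫⁻ t, F t < ⊤ := by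
    rw [hF, lintegral_indicator measurableSet_Icc]
    exact lintegral_Icc_abs_rpow_lt_top hα _
  refine ⟨(∫⁻ t, F t).toNNReal, fun E ↦ ?_⟩
  rw [ENNReal.coe_toNNReal hfin.ne]
  obtain ⟨z, hz, hmin⟩ := isCompact_Icc.exists_isMinOn (nonempty_Icc.2 hpq)
    (f := fun x ↦ |v x - E|) (by fun_prop)
  rw [← lintegral_sub_right_eq_self F z, ← lintegral_indicator measurableSet_Icc]
  refine lintegral_mono_ae ?_
  filter_upwards [compl_mem_ae_iff.2 (measure_singleton z)] with x hxz
  by_cases hx : x ∈ Icc p q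
  · have hxz' : 0 < |x - z| := abs_pos.2 (sub_ne_zero.2 hxz)
    have hmem : x - z ∈ Icc (-(q - p)) (q - p) :=
      ⟨by linarith [hx.1, hz.2], by linarith [hx.2, hz.1]⟩
    rw [hF, indicator_of_mem hx, indicator_of_mem hmem]
    refine ENNReal.ofReal_le_ofReal ?_
    have hlow : c / 2 * |x - z| ^ n ≤ |v x - E| := by
      have h2 := h x hx z hz
      have h3 : |v z - E| ≤ |v x - E| := hmin hx
      have h4 := abs_sub_le (v x) E (v z)
      rw [abs_sub_comm E] at h4
      linarith
    calc |v x - E| ^ (-σ) ≤ (c / 2 * |x - z| ^ n) ^ (-σ) :=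
          Real.rpow_le_rpow_of_nonpos (by positivity) hlow (by linarith)
      _ = (c / 2) ^ (-σ) * |x - z| ^ (-(n * σ)) := by
          rw [Real.mul_rpow (by positivity) (by positivity), ← Real.rpow_natCast,
            ← Real.rpow_mul hxz'.le, mul_neg]
  · rw [indicator_of_notMem hx]
    exact zero_le

/-- **Lemma.** For a nonconstant real analytic `v` on `𝕋` there is `σ₀ = σ₀(v) > 0` such
that for every `0 < σ₂ < σ₀` there is `C = C(σ₂,v) > 0` with
`∫_𝕋 |v(x) − E|^{−σ₂} dx ≤ C` for every `E ∈ ℝ`. -/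
theorem negative_power_integrable (v : ℝ → ℝ)
    (hva : ∀ x : ℝ, AnalyticAt ℝ v x)
    (hvper : ∀ x : ℝ, v (x + 1) = v x)
    (hvnc : ∃ a b : ℝ, v a ≠ v b) :
    ∃ σ₀ > (0 : ℝ), ∀ σ₂ : ℝ, 0 < σ₂ → σ₂ < σ₀ →
      ∃ C > (0 : ℝ), ∀ E : ℝ,
        (∫ x in (0 : ℝ)..1, |v x - E| ^ (-σ₂)) ≤ C := by
  have hv : Continuous v := continuous_iff_continuousAt.2 fun x ↦ (hva x).continuousAt
  have hbound : UniformNegPowerBound v (Icc 0 1) := by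
    refine isCompact_Icc.induction_on (p := UniformNegPowerBound v)
      ⟨1, one_pos, fun σ _ _ ↦ ⟨0, fun E ↦ by simp⟩⟩ (fun s t ↦ UniformNegPowerBound.mono)
      (fun s t ↦ UniformNegPowerBound.union) fun x₀ _ ↦ ?_
    obtain ⟨r, hr, c, hc, n, h⟩ := exists_pow_le_abs_sub_right hva hvnc x₀
    obtain ⟨r', hr', c', hc', n', h'⟩ := exists_pow_le_abs_sub_left hva hvnc x₀
    refine ⟨Icc (x₀ - r') x₀ ∪ Icc x₀ (x₀ + r), mem_nhdsWithin_of_mem_nhds ?_,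
      (UniformNegPowerBound.of_pow_le_abs_sub hv (by linarith) hc' h').union
      (UniformNegPowerBound.of_pow_le_abs_sub hv (by linarith) hc h)⟩
    rw [Icc_union_Icc_eq_Icc (by linarith) (by linarith)]
    exact Icc_mem_nhds (by linarith) (by linarith)
  obtain ⟨σ₀, hσ₀, h⟩ := hbound
  refine ⟨σ₀, hσ₀, fun σ h0 h1 ↦ ?_⟩
  obtain ⟨C, hC⟩ := h σ h0 h1
  refine ⟨C + 1, by positivity, fun E ↦ ?_⟩
  have hmeas : Measurable fun x ↦ |v x - E| ^ (-σ) :=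
    (hv.measurable.sub_const E).norm.pow_const _
  rw [intervalIntegral.integral_of_le zero_le_one, ← integral_Icc_eq_integral_Ioc,
    integral_eq_lintegral_of_nonneg_ae (ae_of_all _ fun x ↦ by positivity)
      hmeas.aestronglyMeasurable]
  have := ENNReal.toReal_mono ENNReal.coe_ne_top (hC E)
  rw [ENNReal.coe_toReal] at this
  linarith

end
end
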